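/- arXiv:1804.05952 — 2 statements merged into one kernel-verified Lean document; each statement's English description precedes it below -/
import Mathlib

section
/- For every integer m ≥ 1, B(m,2) = m and B(m,3) = m. -/
open Set

/-- A point in the plane. -/
abbrev Pt : Type := ℝ × ℝ

/-- The point set `P` contains an `n`-up-run: `n` points with strictly increasing
`x`-coordinates and nondecreasing `y`-coordinates. -/
def HasUpRun (P : Set Pt) (n : ℕ) : Prop :=
  ∃ f : Fin n → Pt, (∀ i, f i ∈ P) ∧
    StrictMono (fun i => (f i).1) ∧ Monotone (fun i => (f i).2)

/-- The point set `P` contains an `n`-down-run: `n` points with strictly increasing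
`x`-coordinates and strictly decreasing `y`-coordinates. -/
def HasDownRun (P : Set Pt) (n : ℕ) : Prop :=
  ∃ f : Fin n → Pt, (∀ i, f i ∈ P) ∧
    StrictMono (fun i => (f i).1) ∧ StrictAnti (fun i => (f i).2)

/-- A strategy for player A: from the list of previously played points, choose
an x-coordinate. -/
abbrev AStrat : Type := List Pt → ℝ

/-- A strategy for player B: from the list of previously played points and the new
x-coordinate, choose a y-coordinate. -/
abbrev BStrat : Type := List Pt → ℝ → ℝ

/-- Validity of a strategy for player A in either game: the chosen x-coordinate lies in
`(0,1)` and is distinct from all previously played x-coordinates. -/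
def AValid (sA : AStrat) : Prop :=
  ∀ h : List Pt, sA h ∈ Ioo (0:ℝ) 1 ∧ ∀ p ∈ h, sA h ≠ p.1

/-- Validity of a strategy for player B in the game `A_{m,k}`: the chosen y-coordinate
lies in `(0,1)` and is distinct from all previously played y-coordinates. -/
def BValid (sB : BStrat) : Prop :=
  ∀ (h : List Pt) (x : ℝ), sB h x ∈ Ioo (0:ℝ) 1 ∧ ∀ p ∈ h, sB h x ≠ p.2

/-- The list of points played in the first `n` turns when A plays `sA` and B plays `sB`. -/
def hist (sA : AStrat) (sB : BStrat) : ℕ → List Pt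
  | 0 => []
  | n + 1 =>
      let h := hist sA sB n
      h ++ [(sA h, sB h (sA h))]

/-- The set of points played in the first `N` turns. -/
def played (sA : AStrat) (sB : BStrat) (N : ℕ) : Set Pt :=
  {p | p ∈ hist sA sB N}

/-- In the game `A_{m,k}`, strategy `sA` of player A is valid and guarantees an
`m`-up-run or a `k`-down-run among the first `N` points, against every valid
strategy of player B. -/
def AWinsBy (m k N : ℕ) (sA : AStrat) : Prop :=
  AValid sA ∧ ∀ sB : BStrat, BValid sB →
    HasUpRun (played sA sB N) m ∨ HasDownRun (played sA sB N) k

/-- The Erdős–Szekeres on-line number `ESO(m,k)`: the least `N` such that player A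
has a strategy forcing an `m`-up-run or a `k`-down-run within `N` turns. -/
noncomputable def ESO (m k : ℕ) : ℕ := sInf {N | ∃ sA : AStrat, AWinsBy m k N sA}

/-- Validity of a strategy for player B in the tier game `B_{m,k}`: the chosen
y-coordinate is an integer in `{1, …, k-1}` (repetitions allowed). -/
def BTierValid (k : ℕ) (sB : BStrat) : Prop :=
  ∀ (h : List Pt) (x : ℝ), ∃ j : ℕ, 1 ≤ j ∧ j ≤ k - 1 ∧ sB h x = (j : ℝ)

/-- In the tier game `B_{m,k}`, strategy `sA` of player A is valid and guarantees an
`m`-up-run among the first `N` points, against every valid strategy of player B. -/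
def AWinsTierBy (m k N : ℕ) (sA : AStrat) : Prop :=
  AValid sA ∧ ∀ sB : BStrat, BTierValid k sB → HasUpRun (played sA sB N) m

/-- `B(m,k)`: the least `N` such that player A has a strategy forcing an `m`-up-run
within `N` turns of the tier game `B_{m,k}`. -/
noncomputable def BNum (m k : ℕ) : ℕ := sInf {N | ∃ sA : AStrat, AWinsTierBy m k N sA}

/-- Player A's invariant in the tier game with two tiers: a nonempty open interval inside
`(0,1)` has all points of the lower tier on its left and all points of the upper tier on
its right. -/
def TierSeparated (h : List Pt) : Prop :=
  ∃ a b : ℝ, 0 ≤ a ∧ a < b ∧ b ≤ 1 ∧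
    ∀ p ∈ h, (p.2 = 1 ∧ p.1 ≤ a) ∨ (p.2 = 2 ∧ b ≤ p.1)

theorem tierSeparated_nil : TierSeparated [] :=
  ⟨0, 1, le_rfl, one_pos, le_rfl, by simp⟩

/-- A move inside the separating interval keeps the tiers separated whatever B answers. -/
theorem exists_separating_move (h : List Pt) :
    ∃ x : ℝ, (x ∈ Ioo (0:ℝ) 1 ∧ ∀ p ∈ h, x ≠ p.1) ∧
      (TierSeparated h → ∀ y : ℝ, y = 1 ∨ y = 2 → TierSeparated (h ++ [(x, y)])) := by
  by_cases hs : TierSeparated h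
  · obtain ⟨a, b, ha, hab, hb, hp⟩ := hs
    refine ⟨(a + b) / 2, ⟨⟨by linarith, by linarith⟩, fun p hph => ?_⟩, fun _ y hy => ?_⟩
    · rcases hp p hph with ⟨-, h'⟩ | ⟨-, h'⟩
      · exact ne_of_gt (by linarith)
      · exact ne_of_lt (by linarith)
    · rcases hy with rfl | rfl
      · refine ⟨(a + b) / 2, b, by linarith, by linarith, hb, fun p hph => ?_⟩
        rcases List.mem_append.1 hph with hph | hph
        · exact (hp p hph).imp (fun h' => ⟨h'.1, by linarith [h'.2]⟩) id
        · obtain rfl := List.mem_singleton.1 hph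
          exact Or.inl ⟨rfl, le_rfl⟩
      · refine ⟨a, (a + b) / 2, ha, by linarith, by linarith, fun p hph => ?_⟩
        rcases List.mem_append.1 hph with hph | hph
        · exact (hp p hph).imp id (fun h' => ⟨h'.1, by linarith [h'.2]⟩)
        · obtain rfl := List.mem_singleton.1 hph
          exact Or.inr ⟨rfl, le_rfl⟩
  · obtain ⟨x, hx, hxs⟩ := (Ioo_infinite (zero_lt_one' ℝ)).exists_notMem_finset
      (h.map Prod.fst).toFinset
    refine ⟨x, ⟨hx, fun p hp he => hxs ?_⟩, fun h' => absurd h' hs⟩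
    rw [List.mem_toFinset, he]
    exact List.mem_map_of_mem hp

theorem length_hist (sA : AStrat) (sB : BStrat) (n : ℕ) : (hist sA sB n).length = n := by
  induction n with
  | zero => rfl
  | succ n ih => simp [hist, ih]

theorem nodup_map_fst_hist {sA : AStrat} (hA : AValid sA) (sB : BStrat) (n : ℕ) :
    ((hist sA sB n).map Prod.fst).Nodup := by
  induction n with
  | zero => simp [hist]
  | succ n ih =>
    simp only [hist, List.map_append, List.map_cons, List.map_nil]
    refine List.nodup_append.2 ⟨ih, List.nodup_singleton _, fun x hx y hy => ?_⟩
    obtain ⟨p, hp, rfl⟩ := List.mem_map.1 hx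
    rw [List.mem_singleton.1 hy]
    exact ((hA _).2 p hp).symm

theorem TierSeparated.hasUpRun {h : List Pt} (hs : TierSeparated h)
    (hd : (h.map Prod.fst).Nodup) : HasUpRun {p | p ∈ h} h.length := by
  have hc : (h.map Prod.fst).toFinset.card = h.length := by
    rw [List.toFinset_card_of_nodup hd, List.length_map]
  have hmem : ∀ i, ∃ p ∈ h, p.1 = (h.map Prod.fst).toFinset.orderEmbOfFin hc i := fun i => by
    simpa only [List.mem_toFinset, List.mem_map] using
      Finset.orderEmbOfFin_mem (h.map Prod.fst).toFinset hc i
  choose f hf hfx using hmem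
  have hmono : StrictMono fun i => (f i).1 := by
    simp only [hfx]
    exact OrderEmbedding.strictMono _
  obtain ⟨a, b, -, hab, -, hp⟩ := hs
  refine ⟨f, hf, hmono, fun i j hij => ?_⟩
  have hle : (f i).1 ≤ (f j).1 := hmono.monotone hij
  change (f i).2 ≤ (f j).2
  rcases hp _ (hf i) with ⟨h1, h2⟩ | ⟨h1, h2⟩ <;>
    rcases hp _ (hf j) with ⟨h3, h4⟩ | ⟨h3, h4⟩ <;> linarith

theorem HasUpRun.le_of_played {sA : AStrat} {sB : BStrat} {m N : ℕ}
    (h : HasUpRun (played sA sB N) m) : m ≤ N := by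
  obtain ⟨f, hf, hx, -⟩ := h
  have hinj : Function.Injective f := fun i j hij => hx.injective (congrArg Prod.fst hij)
  calc m = (Finset.univ.image f).card := by
        rw [Finset.card_image_of_injective _ hinj, Finset.card_univ, Fintype.card_fin]
    _ ≤ (hist sA sB N).toFinset.card := Finset.card_le_card fun p hp => by
        obtain ⟨i, -, rfl⟩ := Finset.mem_image.1 hp
        exact List.mem_toFinset.2 (hf i)
    _ ≤ (hist sA sB N).length := List.toFinset_card_le _
    _ = N := length_hist sA sB N

theorem exists_aWinsTierBy_three (m : ℕ) : ∃ sA : AStrat, AWinsTierBy m 3 m sA := by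
  choose sA hA hsep using exists_separating_move
  refine ⟨sA, hA, fun sB hB => ?_⟩
  have hs : ∀ n, TierSeparated (hist sA sB n) := fun n => by
    induction n with
    | zero => exact tierSeparated_nil
    | succ n ih =>
      refine hsep _ ih _ ?_
      obtain ⟨j, hj1, hj2, hj⟩ := hB (hist sA sB n) (sA (hist sA sB n))
      rw [hj]
      norm_cast
      omega
  simpa only [length_hist, played] using (hs m).hasUpRun (nodup_map_fst_hist hA sB m)

theorem BTierValid.mono {k l : ℕ} (hkl : k ≤ l) {sB : BStrat} (h : BTierValid k sB) :
    BTierValid l sB := fun t x => by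
  obtain ⟨j, h1, h2, h3⟩ := h t x
  exact ⟨j, h1, by omega, h3⟩

theorem BNum_eq_of_le_three {m k : ℕ} (hk : 2 ≤ k) (hk' : k ≤ 3) : BNum m k = m := by
  have hwin : m ∈ {N | ∃ sA : AStrat, AWinsTierBy m k N sA} := by
    obtain ⟨sA, hA, h⟩ := exists_aWinsTierBy_three m
    exact ⟨sA, hA, fun sB hB => h sB (hB.mono hk')⟩
  refine le_antisymm (Nat.sInf_le hwin) (le_csInf ⟨m, hwin⟩ ?_)
  rintro N ⟨sA, -, h⟩
  exact (h (fun _ _ => 1) fun _ _ => ⟨1, le_rfl, by omega, by simp⟩).le_of_played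

theorem BNum_two_and_three (m : ℕ) (hm : 1 ≤ m) :
    BNum m 2 = m ∧ BNum m 3 = m :=
  ⟨BNum_eq_of_le_three le_rfl (by norm_num), BNum_eq_of_le_three (by norm_num) le_rfl⟩
end

section
/- Let P be a nonempty finite set of points in (0,1)×(0,1) with pairwise distinct x-coordinates and pairwise distinct y-coordinates, and let x̂ ∈ (0,1) be distinct from every x-coordinate of a point of P. Then there exists ŷ ∈ (0,1), distinct from every y-coordinate of a point of P, such that the maximum size of an up-run contained in P ∪ {(x̂,ŷ)} equals the maximum size of an up-run contained in P. -/
open Set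

/-- The maximum size of an up-run contained in the point set `P`. -/
noncomputable def maxUpRun (P : Set Pt) : ℕ := sSup {n | HasUpRun P n}

theorem HasUpRun.mono {P Q : Set Pt} {n : ℕ} (hPQ : P ⊆ Q) : HasUpRun P n → HasUpRun Q n :=
  fun ⟨f, hf, hx, hy⟩ => ⟨f, fun i => hPQ (hf i), hx, hy⟩

theorem HasUpRun.of_le {P : Set Pt} {m n : ℕ} (hmn : m ≤ n) : HasUpRun P n → HasUpRun P m :=
  fun ⟨f, hf, hx, hy⟩ => ⟨fun i => f (Fin.castLE hmn i), fun _ => hf _,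
    fun _ _ h => hx (Fin.strictMono_castLE hmn h),
    fun _ _ h => hy ((Fin.strictMono_castLE hmn).monotone h)⟩

theorem HasUpRun.zero (P : Set Pt) : HasUpRun P 0 :=
  ⟨Fin.elim0, fun i => i.elim0, fun i => i.elim0, fun i => i.elim0⟩

/-- Prepending a point that lies to the left of, and not above, all points of `P`. -/
theorem HasUpRun.insert {P : Set Pt} {n : ℕ} {p : Pt} (hp : ∀ q ∈ P, p.1 < q.1 ∧ p.2 ≤ q.2) :
    HasUpRun P n → HasUpRun (insert p P) (n + 1) := by
  rintro ⟨f, hf, hx, hy⟩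
  refine ⟨Fin.cons p f, ?_, ?_, ?_⟩
  · refine Fin.cases (by simp) fun i => ?_
    simpa using Or.inr (hf i)
  · refine Fin.cases (Fin.cases (by simp) fun j _ => ?_) fun i => Fin.cases (by simp) fun j h => ?_
    · simpa using (hp _ (hf j)).1
    · simpa using hx (Fin.succ_lt_succ_iff.1 h)
  · refine Fin.cases (Fin.cases (by simp) fun j _ => ?_) fun i => Fin.cases (by simp) fun j h => ?_
    · simpa using (hp _ (hf j)).2
    · simpa using hy (Fin.succ_le_succ_iff.1 h)

theorem bddAbove_hasUpRun {P : Set Pt} (hP : P.Finite) : BddAbove {n | HasUpRun P n} := by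
  refine ⟨P.ncard, ?_⟩
  rintro n ⟨f, hf, hx, -⟩
  have hinj : Function.Injective f := fun i j h => hx.injective (congrArg Prod.fst h)
  have h := Set.ncard_le_ncard (Set.range_subset_iff.2 hf) hP
  rwa [Set.ncard_range_of_injective hinj, Nat.card_fin] at h

theorem HasUpRun.le_maxUpRun {P : Set Pt} (hP : P.Finite) {n : ℕ} (h : HasUpRun P n) :
    n ≤ maxUpRun P :=
  le_csSup (bddAbove_hasUpRun hP) h

/-- A finite set of points avoids some height in `(c, b)` together with all heights between it and `c`. -/
theorem exists_between_forall_lt (P : Finset Pt) {c b : ℝ} (hcb : c < b) :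
    ∃ y ∈ Ioo c b, ∀ p ∈ P, c < p.2 → y < p.2 := by
  have h : ∀ᶠ y in nhdsWithin c (Ioi c), ∀ p ∈ P, c < p.2 → y < p.2 := by
    rw [Filter.eventually_all_finset]
    intro p _
    by_cases hc : c < p.2
    · filter_upwards [Ioo_mem_nhdsGT hc] with y hy _ using hy.2
    · exact Filter.Eventually.of_forall fun y h => absurd h hc
  exact ((Filter.eventually_of_mem (Ioo_mem_nhdsGT hcb) fun _ h => h).and h).exists

/-- There is a height below all points left of `xh` such that the points above that height and
right of `xh` contain no up-run of maximum size. -/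
theorem exists_height_separating (P : Finset Pt) (hne : P.Nonempty)
    (hmem : ∀ p ∈ P, p.2 ∈ Ioo (0:ℝ) 1) (xh : ℝ) :
    ∃ c ∈ Ico (0:ℝ) 1, (∀ p ∈ P, p.1 < xh → c < p.2) ∧
      ¬ HasUpRun {p | p ∈ P ∧ xh < p.1 ∧ c < p.2} (maxUpRun ↑P) := by
  classical
  set M := maxUpRun (↑P : Set Pt)
  have hpos : 0 < M := by
    obtain ⟨p, hp⟩ := hne
    have h : HasUpRun (↑P : Set Pt) 1 :=
      ⟨fun _ => p, fun _ => hp, Subsingleton.strictMono _, monotone_const⟩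
    exact h.le_maxUpRun P.finite_toSet
  have hlow : ∀ c : ℝ, HasUpRun {p | p ∈ P ∧ xh < p.1 ∧ c < p.2} M →
      ∃ q ∈ P, c < q.2 ∧ HasUpRun {p | p ∈ P ∧ xh < p.1 ∧ q.2 ≤ p.2} M := by
    rintro c ⟨f, hf, hx, hy⟩
    let z : Fin M := ⟨0, hpos⟩
    exact ⟨f z, (hf z).1, (hf z).2.2, f,
      fun i => ⟨(hf i).1, (hf i).2.1, hy (Fin.mk_le_of_le_val (Nat.zero_le _))⟩, hx, hy⟩
  let Q := P.filter fun q => HasUpRun {p | p ∈ P ∧ xh < p.1 ∧ q.2 ≤ p.2} M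
  rcases Q.eq_empty_or_nonempty with hQ | hQ
  · refine ⟨0, ⟨le_rfl, one_pos⟩, fun p hp _ => (hmem p hp).1, fun h => ?_⟩
    obtain ⟨q, hq, -, hrun⟩ := hlow 0 h
    exact Finset.notMem_empty q (hQ ▸ Finset.mem_filter.2 ⟨hq, hrun⟩)
  · obtain ⟨q, hqQ, hmax⟩ := Q.exists_max_image Prod.snd hQ
    obtain ⟨hqP, hrun⟩ := Finset.mem_filter.1 hqQ
    refine ⟨q.2, ⟨(hmem q hqP).1.le, (hmem q hqP).2⟩, fun p hp hpx => ?_, fun h => ?_⟩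
    · by_contra! hle
      have hlong := (hrun.insert (p := p)
        fun r hr => ⟨hpx.trans hr.2.1, hle.trans hr.2.2⟩).mono (Q := (↑P : Set Pt))
        (Set.insert_subset hp fun r hr => hr.1)
      have := hlong.le_maxUpRun P.finite_toSet
      omega
    · obtain ⟨r, hr, hlt, hrrun⟩ := hlow q.2 h
      exact (hmax r (Finset.mem_filter.2 ⟨hr, hrrun⟩)).not_gt hlt

theorem exists_y_not_increasing_maxUpRun (P : Finset Pt) (hne : P.Nonempty)
    (hmem : ∀ p ∈ P, p.1 ∈ Ioo (0:ℝ) 1 ∧ p.2 ∈ Ioo (0:ℝ) 1)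
    (hx : ∀ p ∈ P, ∀ q ∈ P, p ≠ q → p.1 ≠ q.1)
    (hy : ∀ p ∈ P, ∀ q ∈ P, p ≠ q → p.2 ≠ q.2)
    (xh : ℝ) (hxh : xh ∈ Ioo (0:ℝ) 1) (hxh' : ∀ p ∈ P, xh ≠ p.1) :
    ∃ yh ∈ Ioo (0:ℝ) 1, (∀ p ∈ P, yh ≠ p.2) ∧
      maxUpRun (↑P ∪ {(xh, yh)}) = maxUpRun ↑P := by
  obtain ⟨c, hc, hleft, hright⟩ :=
    exists_height_separating P hne (fun p hp => (hmem p hp).2) xh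
  obtain ⟨yh, hyh, hgap⟩ := exists_between_forall_lt P hc.2
  have hyne : ∀ p ∈ P, yh ≠ p.2 := fun p hp h =>
    (hgap p hp (h ▸ hyh.1)).ne h
  refine ⟨yh, ⟨hc.1.trans_lt hyh.1, hyh.2⟩, hyne, le_antisymm ?_ ?_⟩
  · refine csSup_le ⟨0, HasUpRun.zero _⟩ ?_
    rintro n ⟨f, hf, hfx, hfy⟩
    have hfP : ∀ i, f i ≠ (xh, yh) → f i ∈ P := fun i hi => (hf i).resolve_right hi
    by_cases hnew : ∃ i, f i = (xh, yh)
    · obtain ⟨i, hi⟩ := hnew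
      have hfirst : ∀ j, i ≤ j := by
        intro j
        by_contra! hji
        have hxj : (f j).1 < xh := by simpa [hi] using hfx hji
        have hyj : (f j).2 ≤ yh := by simpa [hi] using hfy hji.le
        have hjP := hfP j fun h => by simp [h] at hxj
        exact (hgap _ hjP (hleft _ hjP hxj)).not_ge hyj
      obtain _ | m := n
      · exact i.elim0
      obtain rfl : i = 0 := le_antisymm (hfirst 0) (Fin.zero_le i)
      by_contra! hlt
      refine hright (HasUpRun.of_le (Nat.lt_succ_iff.1 hlt)
        ⟨fun j => f j.succ, fun j => ?_, fun _ _ h => hfx (Fin.succ_lt_succ_iff.2 h),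
          fun _ _ h => hfy (Fin.succ_le_succ_iff.2 h)⟩)
      have hxj : xh < (f j.succ).1 := by simpa [hi] using hfx (Fin.succ_pos j)
      have hyj : yh ≤ (f j.succ).2 := by simpa [hi] using hfy (Fin.succ_pos j).le
      exact ⟨hfP _ fun h => by simp [h] at hxj, hxj, hyh.1.trans_le hyj⟩
    · push Not at hnew
      exact HasUpRun.le_maxUpRun P.finite_toSet ⟨f, fun i => hfP i (hnew i), hfx, hfy⟩
  · exact csSup_le_csSup (bddAbove_hasUpRun (P.finite_toSet.union (Set.finite_singleton _)))
      ⟨0, HasUpRun.zero _⟩ fun n h => h.mono Set.subset_union_left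
end
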